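/- Let g be an affine Lie algebra with set of simple roots Π, Weyl group W, ρ with ⟨ρ,α^∨⟩ = 1 for all α ∈ Π, and minimal imaginary root δ. If λ ∈ Σ_{α∈Π} ℚα is such that λ + ρ is a maximal element of a regular W-orbit and ⟨λ,α^∨⟩ ∈ ℤ for every α ∈ Π, then λ ∈ ℚδ. -/

import Mathlib

/- Common framework: the ring of formal exponential sums with cone-bounded
support, infinite products, reflections and Weyl groups. -/

noncomputable section

namespace DenomId

open scoped Classical

variable {V : Type*} [AddCommGroup V] [Module ℚ V]

/-- The formal exponential `e^ν`, viewed as a formal sum `V → ℚ`. -/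
def expF (ν : V) : V → ℚ := fun μ => if μ = ν then 1 else 0

/-- Convolution product of formal sums (`(f·g)_ν = Σ_{μ} f_μ g_{ν-μ}`). -/
def mulF (f g : V → ℚ) : V → ℚ := fun ν => ∑ᶠ μ : V, f μ * g (ν - μ)

/-- Support of a formal sum. -/
def suppF (f : V → ℚ) : Set V := {ν | f ν ≠ 0}

/-- `Q⁺`: the set of `ℤ_{≥0}`-linear combinations of elements of `P`. -/
def coneOf (P : Set V) : Set V :=
  {ν | ∃ c : V →₀ ℕ, (↑c.support : Set V) ⊆ P ∧ ν = c.sum (fun α n => (n : ℚ) • α)}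

/-- A formal sum belongs to the ring `𝓡` iff its support lies in a finite
union of cones `λ - Q⁺`. -/
def IsConeSupported (P : Set V) (f : V → ℚ) : Prop :=
  ∃ L : Finset V, suppF f ⊆ ⋃ l ∈ L, {μ | ∃ q ∈ coneOf P, μ = l - q}

/-- Action of `GL(V)` on formal sums: `w(e^ν) = e^{wν}`. -/
def actF (w : V ≃ₗ[ℚ] V) (f : V → ℚ) : V → ℚ := fun ν => f (w.symm ν)

/-- `sgn(w) = det w`. -/
def sgnF (w : V ≃ₗ[ℚ] V) : ℚ := LinearMap.det (w : V →ₗ[ℚ] V)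

/-- Coefficientwise (pointwise) sum of a family of formal sums. -/
def sumF {ι : Sort*} (s : ι → V → ℚ) : V → ℚ := fun ν => ∑ᶠ i, s i ν

/-- Expansion of the (possibly infinite) product `∏_{α ∈ X} (1 + a e^{-α})`
as a formal sum: the coefficient of `e^ν` is `Σ_{F ⊆ X finite, Σ F = -ν} a^{|F|}`. -/
def prodF (X : Set V) (a : ℚ) : V → ℚ :=
  fun ν => ∑ᶠ (F : Finset V) (_ : (↑F : Set V) ⊆ X ∧ F.sum id = -ν), a ^ F.card


/-- Appendix lemma: let `g` be an affine Lie algebra given by an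
indecomposable Cartan matrix `a i j = ⟨α_j, α_i^∨⟩` of affine type (i.e. with a
positive null vector `d`, `δ = Σ d_i α_i` the minimal imaginary root), `W` its
Weyl group and `ρ` with `⟨ρ,α^∨⟩ = 1` for all simple `α`. If
`λ ∈ Σ_{α∈Π} ℚα` is such that `λ + ρ` is a maximal element of a regular
`W`-orbit and `⟨λ,α^∨⟩ ∈ ℤ` for all `α ∈ Π`, then `λ ∈ ℚδ`. -/
theorem affine_regular_maximal_implies_multiple_of_delta
    {I : Type} [Fintype I] [DecidableEq I] [Nonempty I]
    {V : Type*} [AddCommGroup V] [Module ℚ V]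
    (sroot : I → V) (scoroot : I → V →ₗ[ℚ] ℚ)
    (hlin : LinearIndependent ℚ sroot)
    -- the Cartan matrix conditions
    (hdiag : ∀ i, scoroot i (sroot i) = 2)
    (hoff : ∀ i j, i ≠ j → scoroot i (sroot j) ≤ 0 ∧ ∃ k : ℤ, scoroot i (sroot j) = (k : ℚ))
    (hzero : ∀ i j, scoroot i (sroot j) = 0 ↔ scoroot j (sroot i) = 0)
    -- indecomposability
    (hindec : ∀ s : Set I, s.Nonempty →
      (∀ i ∈ s, ∀ j, j ∉ s → scoroot i (sroot j) = 0) → s = Set.univ)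
    -- affine type: a positive vector in the kernel of the Cartan matrix
    (d : I → ℚ) (hd : ∀ i, 0 < d i)
    (hker : ∀ i, ∑ j, scoroot i (sroot j) * d j = 0)
    (δ : V) (hδ : δ = ∑ i, d i • sroot i)
    -- the simple reflections and the Weyl group
    (s : I → V ≃ₗ[ℚ] V) (hs : ∀ i μ, s i μ = μ - scoroot i μ • sroot i)
    (W : Subgroup (V ≃ₗ[ℚ] V)) (hW : W = Subgroup.closure (Set.range s))
    (ρ : V) (hρ : ∀ i, scoroot i ρ = 1)
    (lam : V) (hlam : lam ∈ Submodule.span ℚ (Set.range sroot))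
    (hint : ∀ i, ∃ k : ℤ, scoroot i lam = (k : ℚ))
    -- `λ + ρ` is regular and maximal in its `W`-orbit
    (hregular : ∀ w ∈ W, w (lam + ρ) = lam + ρ → w = 1)
    (hmaximal : ∀ w ∈ W, w (lam + ρ) - (lam + ρ) ∈ coneOf (Set.range sroot) →
      w (lam + ρ) = lam + ρ) :
    ∃ q : ℚ, lam = q • δ := by
  classical
  have hpos : ∀ i, 0 ≤ scoroot i lam := by
    intro i
    have hsW : s i ∈ W := hW ▸ Subgroup.subset_closure ⟨i, rfl⟩
    have hne : sroot i ≠ 0 := hlin.ne_zero i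
    have hfix : s i (lam + ρ) ≠ lam + ρ := by
      intro h
      have h1 := hregular _ hsW h
      have h2 := hs i (sroot i)
      rw [h1, hdiag] at h2
      have h3 : (2 : ℚ) • sroot i = 0 := by
        have : sroot i = sroot i - (2 : ℚ) • sroot i := h2
        exact sub_eq_self.mp this.symm
      rcases smul_eq_zero.mp h3 with h4 | h4
      · norm_num at h4
      · exact hne h4
    obtain ⟨k, hk⟩ := hint i
    by_contra hneg
    have hk0 : k + 1 ≤ 0 := by
      rw [hk] at hneg
      have : ¬ (0 ≤ k) := fun h => hneg (by exact_mod_cast h)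
      omega
    apply hfix
    apply hmaximal _ hsW
    obtain ⟨n, hn⟩ := Int.eq_ofNat_of_zero_le (show 0 ≤ -(k + 1) by omega)
    refine ⟨Finsupp.single (sroot i) n, ?_, ?_⟩
    · intro x hx
      have hx' := Finsupp.support_single_subset hx
      rw [Finset.mem_singleton] at hx'
      exact ⟨i, hx'.symm⟩
    · have hq : (n : ℚ) = -((k : ℚ) + 1) := by
        have : ((n : ℤ) : ℚ) = ((-(k + 1) : ℤ) : ℚ) := by rw [hn]
        push_cast at this
        linarith
      rw [Finsupp.sum_single_index (by simp), hs, map_add, hρ, hk, hq, neg_smul]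
      abel
  obtain ⟨c, hc⟩ := (Submodule.mem_span_range_iff_exists_fun ℚ).mp hlam
  have hcpos : ∀ i, 0 ≤ ∑ j, scoroot i (sroot j) * c j := by
    intro i
    have h := hpos i
    rw [← hc, map_sum] at h
    refine h.trans_eq (Finset.sum_congr rfl fun j _ => ?_)
    rw [map_smul, smul_eq_mul, mul_comm]
  obtain ⟨m, hm⟩ := Finite.exists_min (fun i => c i / d i)
  set t := c m / d m with ht
  have hy : ∀ j, 0 ≤ c j - t * d j := fun j => by
    have := (le_div_iff₀ (hd j)).mp (hm j)
    linarith
  have huniv : {i | c i - t * d i = 0} = Set.univ := by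
    apply hindec
    · refine ⟨m, ?_⟩
      have := (hd m).ne'
      simp only [Set.mem_ofPred_eq, ht]
      field_simp
      ring
    · intro i hi j hj
      simp only [Set.mem_ofPred_eq] at hi hj
      have hsum : ∑ j, scoroot i (sroot j) * (c j - t * d j)
          = ∑ j, scoroot i (sroot j) * c j := by
        have : ∑ j, scoroot i (sroot j) * (c j - t * d j)
          = ∑ j, scoroot i (sroot j) * c j - t * ∑ j, scoroot i (sroot j) * d j := by
          rw [Finset.mul_sum, ← Finset.sum_sub_distrib]
          exact Finset.sum_congr rfl fun j _ => by ring
        rw [this, hker]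
        ring
      have hle : ∀ j ∈ Finset.univ, scoroot i (sroot j) * (c j - t * d j) ≤ 0 := by
        intro j _
        by_cases hij : i = j
        · subst hij
          rw [hi, mul_zero]
        · exact mul_nonpos_of_nonpos_of_nonneg (hoff i j hij).1 (hy j)
      have h0 : ∑ j, scoroot i (sroot j) * (c j - t * d j) = 0 :=
        le_antisymm (Finset.sum_nonpos hle) (hsum ▸ hcpos i)
      have hz := (Finset.sum_eq_zero_iff_of_nonpos hle).mp h0 j (Finset.mem_univ j)
      exact (mul_eq_zero.mp hz).resolve_right hj
  refine ⟨t, ?_⟩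
  rw [← hc, hδ, Finset.smul_sum]
  refine Finset.sum_congr rfl fun j _ => ?_
  have hj : c j - t * d j = 0 := by
    have : j ∈ {i | c i - t * d i = 0} := huniv ▸ Set.mem_univ j
    exact this
  rw [smul_smul, sub_eq_zero.mp hj]


end DenomId
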